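/- Let K be a convex body in ℝⁿ with V(K) = V(B). Then 𝓔_{-n}(K) ≤ n V(B); that is, inf_{x ∈ int K} ∫_{S^{n-1}} (s_K(u) − x·u)^{-n} dθ ≤ n V(B). -/

import Mathlib

open MeasureTheory Metric Real Set
open scoped Pointwise RealInnerProductSpace

noncomputable section

/-- The surface measure `dθ` on the unit sphere `S^{n-1}` of `ℝⁿ`
(its total mass is `n·V(B)`). -/
def sphMeasure (n : ℕ) : Measure (Metric.sphere (0 : EuclideanSpace ℝ (Fin n)) 1) :=
  (volume : Measure (EuclideanSpace ℝ (Fin n))).toSphere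

/-- `K` is a convex body: compact, convex, with nonempty interior. -/
def IsConvexBody {n : ℕ} (K : Set (EuclideanSpace ℝ (Fin n))) : Prop :=
  IsCompact K ∧ Convex ℝ K ∧ (interior K).Nonempty

/-- The support function of `K`: `s_K(u) = max_{x ∈ K} x·u`. -/
def supp {n : ℕ} (K : Set (EuclideanSpace ℝ (Fin n))) (u : EuclideanSpace ℝ (Fin n)) : ℝ :=
  sSup ((fun x => ⟪x, u⟫) '' K)

/-- `n`-dimensional Lebesgue measure (volume), as a real number. -/
def vol {n : ℕ} (K : Set (EuclideanSpace ℝ (Fin n))) : ℝ :=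
  (volume K).toReal

/-- The closed unit ball `B` of `ℝⁿ`. -/
def unitBall (n : ℕ) : Set (EuclideanSpace ℝ (Fin n)) :=
  Metric.closedBall 0 1

/-- The entropy functional `𝓔(K) = sup_{x ∈ int K} ∫_{S^{n-1}} log (s_K(u) - x·u) dθ`. -/
def entropy {n : ℕ} (K : Set (EuclideanSpace ℝ (Fin n))) : ℝ :=
  sSup ((fun x => ∫ u, Real.log (supp K u - ⟪x, (u : EuclideanSpace ℝ (Fin n))⟫)
      ∂(sphMeasure n)) '' interior K)

/-- The `p`-entropy functional `𝓔_p(K) = inf_{x ∈ int K} ∫_{S^{n-1}} (s_K(u) - x·u)^p dθ`. -/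
def entropyP {n : ℕ} (p : ℝ) (K : Set (EuclideanSpace ℝ (Fin n))) : ℝ :=
  sInf ((fun x => ∫ u, (supp K u - ⟪x, (u : EuclideanSpace ℝ (Fin n))⟫) ^ p
      ∂(sphMeasure n)) '' interior K)

/-- The Hausdorff distance between convex bodies,
`δ_H(K,L) = sup_{u ∈ S^{n-1}} |s_K(u) - s_L(u)|`. -/
def hdist {n : ℕ} (K L : Set (EuclideanSpace ℝ (Fin n))) : ℝ :=
  ⨆ u : Metric.sphere (0 : EuclideanSpace ℝ (Fin n)) 1, |supp K u - supp L u|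


theorem bm_compact {A B C : Set ℝ} (hA : IsCompact A) (hB : IsCompact B) (hAn : A.Nonempty)
    (hBn : B.Nonempty) (h : ∀ a ∈ A, ∀ b ∈ B, (a + b) / 2 ∈ C) :
    volume A + volume B ≤ 2 * volume C := by
  obtain ⟨M, hMA, hM⟩ := hA.exists_isGreatest hAn
  obtain ⟨m, hmB, hm⟩ := hB.exists_isLeast hBn
  -- `(A + m)/2` and `(M + B)/2` lie in `C`
  have e1 : volume ((fun x : ℝ => 2⁻¹ * x + m / 2) '' A) = ENNReal.ofReal 2⁻¹ * volume A := by
    have : (fun x : ℝ => 2⁻¹ * x + m / 2) '' A = (fun x => x + m / 2) '' ((2⁻¹ : ℝ) • A) := by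
      rw [← Set.image_smul, Set.image_image]; rfl
    rw [this, Set.image_add_right, measure_preimage_add_right, Measure.addHaar_smul]
    simp
  have e2 : volume ((fun x : ℝ => 2⁻¹ * x + M / 2) '' B) = ENNReal.ofReal 2⁻¹ * volume B := by
    have : (fun x : ℝ => 2⁻¹ * x + M / 2) '' B = (fun x => x + M / 2) '' ((2⁻¹ : ℝ) • B) := by
      rw [← Set.image_smul, Set.image_image]; rfl
    rw [this, Set.image_add_right, measure_preimage_add_right, Measure.addHaar_smul]
    simp
  set A' := (fun x : ℝ => 2⁻¹ * x + m / 2) '' A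
  set B' := (fun x : ℝ => 2⁻¹ * x + M / 2) '' B
  have hA' : A' ⊆ C := by
    rintro _ ⟨a, ha, rfl⟩
    have := h a ha m hmB
    convert this using 1; ring
  have hB' : B' ⊆ C := by
    rintro _ ⟨b, hb, rfl⟩
    have := h M hMA b hb
    convert this using 1; ring
  have hmeas : MeasurableSet B' := (hB.image (by fun_prop)).isClosed.measurableSet
  have hdis : AEDisjoint volume A' B' := by
    have : A' ∩ B' ⊆ {(M + m) / 2} := by
      rintro _ ⟨⟨a, ha, rfl⟩, ⟨b, hb, hab⟩⟩
      have h1 := hM ha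
      have h2 := hm hb
      simp only [mem_singleton_iff] at *
      linarith
    exact measure_mono_null this (by simp)
  have key : volume A' + volume B' ≤ volume C := by
    rw [← measure_union₀ hmeas.nullMeasurableSet hdis]
    exact measure_mono (union_subset hA' hB')
  rw [e1, e2, ← mul_add] at key
  calc volume A + volume B = 2 * (ENNReal.ofReal 2⁻¹ * (volume A + volume B)) := by
        rw [← mul_assoc, ENNReal.ofReal_inv_of_pos (by norm_num)]
        simp [ENNReal.mul_inv_cancel]
    _ ≤ _ := by gcongr

theorem bm_one {A B C : Set ℝ} (hA : MeasurableSet A) (hB : MeasurableSet B) (hAn : A.Nonempty)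
    (hBn : B.Nonempty) (h : ∀ a ∈ A, ∀ b ∈ B, (a + b) / 2 ∈ C) :
    volume A + volume B ≤ 2 * volume C := by
  have key : ∀ A' ⊆ A, IsCompact A' → ∀ B' ⊆ B, IsCompact B' →
      volume A' + volume B' ≤ 2 * volume C := by
    intro A' hA' cA' B' hB' cB'
    obtain ⟨a, ha⟩ := hAn
    obtain ⟨b, hb⟩ := hBn
    have := bm_compact (A := insert a A') (B := insert b B') (C := C) (cA'.insert a) (cB'.insert b)
      (insert_nonempty _ _) (insert_nonempty _ _) (by
        intro x hx y hy
        exact h x (insert_subset ha hA' hx) y (insert_subset hb hB' hy))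
    refine le_trans ?_ this
    gcongr <;> exact subset_insert _ _
  rw [hA.measure_eq_iSup_isCompact, hB.measure_eq_iSup_isCompact]
  have := ENNReal.biSup_add_biSup_le' (p := fun K => K ⊆ A ∧ IsCompact K)
    (q := fun K => K ⊆ B ∧ IsCompact K) (f := fun K => volume K) (g := fun K => volume K)
    ⟨∅, by simp⟩ ⟨∅, by simp⟩ (a := 2 * volume C)
    (fun i hi j hj => key i hi.1 hi.2 j hj.1 hj.2)
  simpa only [iSup_and] using this

theorem pl_norm {φ ψ χ : ℝ → ℝ} (hφ : Measurable φ) (hψ : Measurable ψ) (hχ : Measurable χ)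
    (hφ0 : ∀ a, 0 ≤ φ a) (hψ0 : ∀ a, 0 ≤ ψ a) (hχ0 : ∀ a, 0 ≤ χ a)
    (hφ1 : ∀ a, φ a ≤ 1) (hψ1 : ∀ a, ψ a ≤ 1)
    (hφs : ∀ t < 1, ∃ a, t < φ a) (hψs : ∀ t < 1, ∃ a, t < ψ a)
    (h : ∀ a b, φ a * ψ b ≤ χ ((a + b) / 2) ^ 2) :
    (∫⁻ x, ENNReal.ofReal (φ x)) + ∫⁻ x, ENNReal.ofReal (ψ x) ≤
      2 * ∫⁻ x, ENNReal.ofReal (χ x) := by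
  rw [lintegral_eq_lintegral_meas_lt _ (Filter.Eventually.of_forall hφ0) hφ.aemeasurable,
    lintegral_eq_lintegral_meas_lt _ (Filter.Eventually.of_forall hψ0) hψ.aemeasurable,
    lintegral_eq_lintegral_meas_lt _ (Filter.Eventually.of_forall hχ0) hχ.aemeasurable]
  have hm : ∀ f : ℝ → ℝ, Measurable fun t : ℝ => volume {a : ℝ | t < f a} := by
    intro f
    apply Antitone.measurable
    intro s t hst
    exact measure_mono fun a (ha : t < f a) => lt_of_le_of_lt hst ha
  rw [← lintegral_add_left (hm φ), ← lintegral_const_mul _ (hm χ)]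
  refine lintegral_mono_ae ?_
  filter_upwards [ae_restrict_mem measurableSet_Ioi] with t ht
  have ht0 : 0 < t := ht
  rcases lt_or_ge t 1 with h1 | h1
  · refine bm_one (measurableSet_lt measurable_const hφ) (measurableSet_lt measurable_const hψ)
      (hφs t h1) (hψs t h1) ?_
    intro a ha b hb
    have ha' : t < φ a := ha
    have hb' : t < ψ b := hb
    have := h a b
    change t < χ ((a + b) / 2)
    refine lt_of_pow_lt_pow_left₀ 2 (hχ0 _) (lt_of_lt_of_le ?_ this)
    nlinarith
  · have e1 : {a | t < φ a} = ∅ := by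
      ext a; simpa using (hφ1 a).trans h1
    have e2 : {a | t < ψ a} = ∅ := by
      ext a; simpa using (hψ1 a).trans h1
    simp [e1, e2]

theorem amgm (a b : ENNReal) : 4 * (a * b) ≤ (a + b) ^ 2 := by
  wlog hab : a ≤ b generalizing a b
  · rw [mul_comm a, add_comm a]; exact this b a (le_of_not_ge hab)
  obtain ⟨d, rfl⟩ := exists_add_of_le hab
  calc 4 * (a * (a + d)) ≤ 4 * (a * (a + d)) + d ^ 2 := le_self_add
    _ = _ := by ring

theorem pl_bdd {φ ψ χ : ℝ → ℝ} (hφ : Measurable φ) (hψ : Measurable ψ) (hχ : Measurable χ)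
    (hφ0 : ∀ a, 0 ≤ φ a) (hψ0 : ∀ a, 0 ≤ ψ a) (hχ0 : ∀ a, 0 ≤ χ a)
    (hφ1 : BddAbove (range φ)) (hψ1 : BddAbove (range ψ))
    (h : ∀ a b, φ a * ψ b ≤ χ ((a + b) / 2) ^ 2) :
    (∫⁻ x, ENNReal.ofReal (φ x)) * ∫⁻ x, ENNReal.ofReal (ψ x) ≤
      (∫⁻ x, ENNReal.ofReal (χ x)) ^ 2 := by
  have hM0 : 0 ≤ ⨆ a, φ a := Real.iSup_nonneg hφ0
  have hL0 : 0 ≤ ⨆ a, ψ a := Real.iSup_nonneg hψ0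
  have hM : ∀ a, φ a ≤ ⨆ a, φ a := fun a => le_ciSup hφ1 a
  have hL : ∀ a, ψ a ≤ ⨆ a, ψ a := fun a => le_ciSup hψ1 a
  have hMs : ∀ t < ⨆ a, φ a, ∃ a, t < φ a := fun t ht => exists_lt_of_lt_ciSup ht
  have hLs : ∀ t < ⨆ a, ψ a, ∃ a, t < ψ a := fun t ht => exists_lt_of_lt_ciSup ht
  generalize (⨆ a, φ a) = M at *
  generalize (⨆ a, ψ a) = L at *
  rcases hM0.eq_or_lt with rfl | hMp
  · have : ∀ a, φ a = 0 := fun a => le_antisymm (hM a) (hφ0 a)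
    simp [this]
  rcases hL0.eq_or_lt with rfl | hLp
  · have : ∀ a, ψ a = 0 := fun a => le_antisymm (hL a) (hψ0 a)
    simp [this]
  have hS : 0 < √(M * L) := by positivity
  have key := pl_norm (φ := fun a => M⁻¹ * φ a) (ψ := fun a => L⁻¹ * ψ a)
    (χ := fun a => (√(M * L))⁻¹ * χ a) (by fun_prop) (by fun_prop) (by fun_prop)
    (fun a => mul_nonneg (by positivity) (hφ0 a)) (fun a => mul_nonneg (by positivity) (hψ0 a))
    (fun a => mul_nonneg (by positivity) (hχ0 a))
    (fun a => by rw [inv_mul_le_iff₀ hMp]; simpa using hM a)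
    (fun a => by rw [inv_mul_le_iff₀ hLp]; simpa using hL a)
    (fun t ht => by
      obtain ⟨a, ha⟩ := hMs (M * t) (by nlinarith)
      exact ⟨a, by rwa [lt_inv_mul_iff₀ hMp]⟩)
    (fun t ht => by
      obtain ⟨a, ha⟩ := hLs (L * t) (by nlinarith)
      exact ⟨a, by rwa [lt_inv_mul_iff₀ hLp]⟩)
    (fun a b => by
      rw [mul_pow, inv_pow, Real.sq_sqrt (by positivity), mul_inv]
      calc M⁻¹ * φ a * (L⁻¹ * ψ b) = M⁻¹ * L⁻¹ * (φ a * ψ b) := by ring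
        _ ≤ _ := by gcongr; exact h a b)
  have hr : ∀ (c : ℝ) (f : ℝ → ℝ), 0 < c → Measurable f →
      ∫⁻ x, ENNReal.ofReal (c * f x) = ENNReal.ofReal c * ∫⁻ x, ENNReal.ofReal (f x) := by
    intro c f hc hf
    simp_rw [ENNReal.ofReal_mul hc.le]
    exact lintegral_const_mul _ (by fun_prop)
  rw [hr _ _ (by positivity) hφ, hr _ _ (by positivity) hψ, hr _ _ (by positivity) hχ] at key
  set I := ∫⁻ x, ENNReal.ofReal (φ x)
  set J := ∫⁻ x, ENNReal.ofReal (ψ x)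
  set H := ∫⁻ x, ENNReal.ofReal (χ x)
  have k2 := (amgm _ _).trans (pow_le_pow_left' key 2)
  have e : ENNReal.ofReal (√(M * L))⁻¹ ^ 2 = ENNReal.ofReal M⁻¹ * ENNReal.ofReal L⁻¹ := by
    rw [← ENNReal.ofReal_pow (by positivity), ← ENNReal.ofReal_mul (by positivity), inv_pow,
      Real.sq_sqrt (by positivity), mul_inv]
  have k3 : (4 * (ENNReal.ofReal M⁻¹ * ENNReal.ofReal L⁻¹)) * (I * J) ≤
      (4 * (ENNReal.ofReal M⁻¹ * ENNReal.ofReal L⁻¹)) * H ^ 2 := by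
    calc _ = 4 * (ENNReal.ofReal M⁻¹ * I * (ENNReal.ofReal L⁻¹ * J)) := by ring
      _ ≤ _ := k2
      _ = _ := by rw [mul_pow, mul_pow, e]; ring
  rwa [ENNReal.mul_le_mul_iff_right] at k3
  · have := hMp; have := hLp
    simp [hMp, hLp]
  · finiteness

theorem pl_enn {φ ψ : ℝ → ENNReal} {χ : ℝ → ℝ} (hφ : Measurable φ) (hψ : Measurable ψ)
    (hχ : Measurable χ) (hχ0 : ∀ a, 0 ≤ χ a)
    (h : ∀ a b, φ a * ψ b ≤ ENNReal.ofReal (χ ((a + b) / 2) ^ 2)) :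
    (∫⁻ x, φ x) * ∫⁻ x, ψ x ≤ (∫⁻ x, ENNReal.ofReal (χ x)) ^ 2 := by
  have hs : ∀ f : ℝ → ENNReal, Measurable f → ∫⁻ x, f x = ⨆ k : ℕ, ∫⁻ x, min (f x) k := by
    intro f hf
    rw [← lintegral_iSup (fun k => by fun_prop)]
    · congr 1; ext x
      apply le_antisymm
      · refine le_of_forall_lt fun c hc => ?_
        obtain ⟨k, hk⟩ := ENNReal.exists_nat_gt (ne_top_of_lt hc)
        exact lt_of_lt_of_le (lt_min hc hk) (le_iSup (fun k : ℕ => min (f x) k) k)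
      · exact iSup_le fun k => min_le_left _ _
    · intro i j hij x
      exact min_le_min_left _ (by exact_mod_cast hij)
  rw [hs φ hφ, hs ψ hψ]
  rw [ENNReal.iSup_mul]
  simp_rw [ENNReal.mul_iSup]
  have hb : ∀ (f : ℝ → ENNReal) (k : ℕ), BddAbove (range fun x => (min (f x) k).toReal) := by
    intro f k
    refine ⟨k, ?_⟩
    rintro _ ⟨x, rfl⟩
    exact ENNReal.toReal_le_of_le_ofReal (by positivity) (by simp)
  have ht : ∀ (f : ℝ → ENNReal) (k : ℕ) x, ENNReal.ofReal ((min (f x) k).toReal) = min (f x) k := by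
    intro f k x
    exact ENNReal.ofReal_toReal (ne_top_of_le_ne_top (ENNReal.natCast_ne_top k) (min_le_right _ _))
  refine iSup_le fun k => iSup_le fun l => ?_
  have := pl_bdd (φ := fun x => (min (φ x) k).toReal) (ψ := fun x => (min (ψ x) l).toReal) (χ := χ)
    (by fun_prop) (by fun_prop) hχ (by simp) (by simp) hχ0 (hb φ k) (hb ψ l) (by
      intro a b
      rw [← ENNReal.toReal_mul]
      refine ENNReal.toReal_le_of_le_ofReal (by positivity) (le_trans ?_ (h a b))
      gcongr <;> simp)
  simpa only [ht] using this

theorem lintegral_Ioi_exp (f : ℝ → ENNReal) :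
    ∫⁻ x in Ioi (0 : ℝ), f x = ∫⁻ x, ENNReal.ofReal (exp x) * f (exp x) := by
  have := lintegral_image_eq_lintegral_abs_deriv_mul (s := univ) (f := exp) (f' := exp)
    MeasurableSet.univ (fun x _ => (Real.hasDerivAt_exp x).hasDerivWithinAt)
    Real.exp_injective.injOn f
  simpa [Real.range_exp, abs_of_pos (Real.exp_pos _)] using this

theorem lintegral_half_gauss :
    ∫⁻ x in Ioi (0 : ℝ), ENNReal.ofReal (exp (-(x ^ 2 / 2))) = ENNReal.ofReal √(π / 2) := by
  have := integral_gaussian_Ioi (1 / 2)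
  have hIntg : Integrable (fun x : ℝ => exp (-(1 / 2) * x ^ 2)) := integrable_exp_neg_mul_sq (by norm_num)
  have e : ∀ x : ℝ, -(x ^ 2 / 2) = -(1 / 2) * x ^ 2 := by intro x; ring
  simp_rw [e]
  rw [← ofReal_integral_eq_lintegral_ofReal hIntg.integrableOn
    (Filter.Eventually.of_forall fun x => (exp_pos _).le), this]
  congr 1
  rw [show π / (1 / 2) = 2 ^ 2 * (π / 2) by ring, Real.sqrt_mul (by norm_num),
    Real.sqrt_sq (by norm_num)]
  ring

theorem half_line {f g : ℝ → ENNReal} (hf : Measurable f) (hg : Measurable g) (c : ENNReal)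
    (h : ∀ s > 0, ∀ t > 0, f s * g t ≤ c * ENNReal.ofReal (exp (-(s * t)))) :
    (∫⁻ s in Ioi (0 : ℝ), f s) * ∫⁻ t in Ioi (0 : ℝ), g t ≤ c * ENNReal.ofReal (π / 2) := by
  by_cases hc : c = ⊤
  · subst hc
    rw [ENNReal.top_mul (by simp [Real.pi_pos])]; exact le_top
  lift c to NNReal using hc
  rw [lintegral_Ioi_exp f, lintegral_Ioi_exp g]
  have key := pl_enn (φ := fun x => ENNReal.ofReal (exp x) * f (exp x))
    (ψ := fun x => ENNReal.ofReal (exp x) * g (exp x))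
    (χ := fun x => √(c : ℝ) * (exp x * exp (-(exp x ^ 2 / 2)))) (by fun_prop) (by fun_prop)
    (by fun_prop) (fun a => by positivity) (by
      intro a b
      have := h (exp a) (exp_pos a) (exp b) (exp_pos b)
      have e1 : (√(c : ℝ) * (exp ((a + b) / 2) * exp (-(exp ((a + b) / 2) ^ 2 / 2)))) ^ 2
          = exp a * exp b * (c * exp (-(exp a * exp b))) := by
        have e2 : exp ((a + b) / 2) ^ 2 = exp a * exp b := by
          rw [← Real.exp_add, ← Real.exp_nat_mul]; congr 1; push_cast; ring
        rw [mul_pow, mul_pow, Real.sq_sqrt (by positivity), e2, ← Real.exp_nat_mul _ 2]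
        push_cast
        rw [show (2 : ℝ) * -(exp a * exp b / 2) = -(exp a * exp b) by ring]
        ring
      rw [e1, ENNReal.ofReal_mul (by positivity), ENNReal.ofReal_mul (by positivity),
        ENNReal.ofReal_mul (by positivity), ENNReal.ofReal_coe_nnreal]
      calc _ = ENNReal.ofReal (exp a) * ENNReal.ofReal (exp b) * (f (exp a) * g (exp b)) := by ring
        _ ≤ _ := by gcongr)
  refine key.trans (le_of_eq ?_)
  simp_rw [ENNReal.ofReal_mul (Real.sqrt_nonneg (c : ℝ)), ENNReal.ofReal_mul (exp_pos _).le]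
  rw [lintegral_const_mul _ (by fun_prop), 
    ← lintegral_Ioi_exp (fun x => ENNReal.ofReal (exp (-(x ^ 2 / 2)))), lintegral_half_gauss,
    mul_pow, ← ENNReal.ofReal_pow (by positivity), ← ENNReal.ofReal_pow (by positivity),
    Real.sq_sqrt (by positivity), Real.sq_sqrt (by positivity), ENNReal.ofReal_coe_nnreal]

theorem jensen_exp {α : Type*} [MeasurableSpace α] {μ : Measure α} [IsFiniteMeasure μ] {a : α → ℝ}
    (ha : Integrable a μ) (h0 : ∫ x, a x ∂μ = 0) :
    μ univ ≤ ∫⁻ x, ENNReal.ofReal (exp (a x)) ∂μ := by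
  by_cases ht : ∫⁻ x, ENNReal.ofReal (exp (a x)) ∂μ = ⊤
  · rw [ht]; exact le_top
  have hm : AEStronglyMeasurable (fun x => exp (a x)) μ :=
    (Real.measurable_exp.comp_aemeasurable ha.aemeasurable).aestronglyMeasurable
  have hIntg : Integrable (fun x => exp (a x)) μ := by
    refine ⟨hm, ?_⟩
    rw [hasFiniteIntegral_iff_ofReal (Filter.Eventually.of_forall fun x => (exp_pos _).le)]
    exact lt_top_iff_ne_top.2 ht
  have h1 : ∫ x, (1 + a x) ∂μ ≤ ∫ x, exp (a x) ∂μ :=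
    integral_mono ((integrable_const (1 : ℝ)).add ha) hIntg
      (fun x => by simpa [add_comm] using Real.add_one_le_exp (a x))
  rw [integral_add (integrable_const _) ha, h0, add_zero] at h1
  simp only [integral_const, smul_eq_mul, mul_one] at h1
  rw [← ofReal_integral_eq_lintegral_ofReal hIntg
    (Filter.Eventually.of_forall fun x => (exp_pos _).le)]
  rw [← ENNReal.ofReal_toReal (measure_ne_top μ univ)]
  exact ENNReal.ofReal_le_ofReal h1

/-- The functional Santaló inequality in dimension `n`. -/
def FSant (n : ℕ) : Prop :=
  ∀ (f g : (Fin n → ℝ) → ENNReal) (c : ENNReal), Measurable f → Measurable g →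
    (∀ z : Fin n → ℝ, ∫⁻ x, f x ≤ ∫⁻ x, f x * ENNReal.ofReal (exp (z ⬝ᵥ x))) →
    (∀ x y, f x * g y ≤ c * ENNReal.ofReal (exp (-(x ⬝ᵥ y)))) →
    (∫⁻ x, f x) * ∫⁻ y, g y ≤ c * ENNReal.ofReal ((2 * π) ^ n)

theorem FSant_zero : FSant 0 := by
  intro f g c hf hg hC h
  have := h 0 0
  simp only [Matrix.dotProduct_of_isEmpty, neg_zero, exp_zero, ENNReal.ofReal_one, mul_one] at this
  have hv : (volume : Measure (Fin 0 → ℝ)) = Measure.dirac 0 := by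
    rw [volume_pi, Measure.pi_of_empty (x := 0)]
  simpa [hv, lintegral_dirac] using this

theorem lintegral_half {E : Type*} [MeasureSpace E] [SFinite (volume : Measure E)]
    {f : ℝ × E → ENNReal} (hf : Measurable f) :
    ∫⁻ z in {z : ℝ × E | 0 < z.1}, f z = ∫⁻ y, ∫⁻ t in Ioi (0 : ℝ), f (t, y) := by
  have : {z : ℝ × E | 0 < z.1} = Ioi (0 : ℝ) ×ˢ univ := by ext z; simp
  rw [this, Measure.volume_eq_prod, ← Measure.prod_restrict, Measure.restrict_univ,
    lintegral_prod_symm _ hf.aemeasurable]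

theorem one_side {n : ℕ} (IH : FSant n) {f g : ℝ × (Fin n → ℝ) → ENNReal} (hf : Measurable f)
    (hg : Measurable g) (c : ENNReal)
    (h : ∀ s > 0, ∀ t > 0, ∀ x y, f (s, x) * g (t, y) ≤
      c * ENNReal.ofReal (exp (-(s * t + x ⬝ᵥ y))))
    (hC : ∀ q : Fin n → ℝ, ∫⁻ z in {z : ℝ × (Fin n → ℝ) | 0 < z.1}, g z ≤
      ∫⁻ z in {z : ℝ × (Fin n → ℝ) | 0 < z.1}, g z * ENNReal.ofReal (exp (q ⬝ᵥ z.2))) :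
    (∫⁻ z in {z : ℝ × (Fin n → ℝ) | 0 < z.1}, f z) *
      (∫⁻ z in {z : ℝ × (Fin n → ℝ) | 0 < z.1}, g z) ≤
      c * ENNReal.ofReal (π / 2) * ENNReal.ofReal ((2 * π) ^ n) := by
  have hdot : ∀ q : Fin n → ℝ, Measurable fun z : Fin n → ℝ => q ⬝ᵥ z := by
    intro q; unfold dotProduct; fun_prop
  rw [lintegral_half hf, lintegral_half hg, mul_comm]
  refine IH (fun y => ∫⁻ t in Ioi (0 : ℝ), g (t, y)) (fun x => ∫⁻ t in Ioi (0 : ℝ), f (t, x)) _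
    ?_ ?_ ?_ ?_
  · exact hg.lintegral_prod_left'
  · exact hf.lintegral_prod_left'
  · intro q
    have := hC q
    have hq := hdot q
    rw [lintegral_half hg, lintegral_half (by fun_prop)] at this
    refine this.trans (le_of_eq ?_)
    congr 1; ext y
    exact lintegral_mul_const (f := fun t => g (t, y)) (ENNReal.ofReal (exp (q ⬝ᵥ y))) (by fun_prop)
  · intro y x
    rw [mul_comm]
    have := half_line (f := fun s => f (s, x)) (g := fun t => g (t, y)) (by fun_prop) (by fun_prop)
      (c * ENNReal.ofReal (exp (-(x ⬝ᵥ y)))) (by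
        intro s hs t ht
        refine (h s hs t ht x y).trans (le_of_eq ?_)
        rw [mul_assoc, ← ENNReal.ofReal_mul (exp_pos _).le, ← Real.exp_add]
        congr 3; ring)
    refine this.trans (le_of_eq ?_)
    rw [dotProduct_comm x y]; ring

theorem exists_median {E : Type*} [MeasureSpace E] [SFinite (volume : Measure E)]
    {g : ℝ × E → ENNReal} (hg : Measurable g) (hfin : ∫⁻ z, g z ≠ ⊤) {R : ℝ}
    (hR : ∀ z : ℝ × E, R < |z.1| → g z = 0) :
    ∃ r : ℝ, ∫⁻ z in {z : ℝ × E | r < z.1}, g z = ∫⁻ z in {z : ℝ × E | z.1 < r}, g z ∧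
      ∫⁻ z, g z = (∫⁻ z in {z : ℝ × E | r < z.1}, g z) + ∫⁻ z in {z : ℝ × E | z.1 < r}, g z := by
  set μ : Measure (ℝ × E) := volume.withDensity g with hμ
  have hμfin : IsFiniteMeasure μ := isFiniteMeasure_withDensity hfin
  have hnull : ∀ r : ℝ, μ {z | z.1 = r} = 0 := by
    intro r
    apply withDensity_absolutelyContinuous
    have : {z : ℝ × E | z.1 = r} = {r} ×ˢ univ := by ext z; simp
    rw [this, Measure.volume_eq_prod, Measure.prod_prod]; simp
  have hms : ∀ r : ℝ, MeasurableSet {z : ℝ × E | z.1 ≤ r} := fun r =>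
    measurableSet_le measurable_fst measurable_const
  have hcont : Continuous fun r : ℝ => μ.real {z | z.1 ≤ r} := by
    have : (fun r : ℝ => μ.real {z | z.1 ≤ r}) =
        fun r => ∫ z, indicator {z : ℝ × E | z.1 ≤ r} (fun _ => (1 : ℝ)) z ∂μ := by
      ext r
      rw [integral_indicator_const _ (hms r)]; simp
    rw [this, continuous_iff_continuousAt]
    intro r
    refine continuousAt_of_dominated (bound := fun _ => 1) ?_ ?_ (integrable_const _) ?_
    · exact Filter.Eventually.of_forall fun s =>
        (measurable_const.indicator (hms s)).aestronglyMeasurable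
    · exact Filter.Eventually.of_forall fun s => Filter.Eventually.of_forall fun z => by
        by_cases hz : z.1 ≤ s <;> simp [indicator, hz]
    · have : ∀ᵐ z ∂μ, z.1 ≠ r := by simpa [ae_iff] using hnull r
      filter_upwards [this] with z hz
      rcases lt_or_gt_of_ne hz with h | h
      · have : (fun _ => (1 : ℝ)) =ᶠ[nhds r] fun s =>
            indicator {z : ℝ × E | z.1 ≤ s} (fun _ => (1 : ℝ)) z := by
          filter_upwards [lt_mem_nhds h] with s hs
          simp [indicator, hs.le]
        exact continuousAt_const.congr this
      · have : (fun _ => (0 : ℝ)) =ᶠ[nhds r] fun s =>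
            indicator {z : ℝ × E | z.1 ≤ s} (fun _ => (1 : ℝ)) z := by
          filter_upwards [gt_mem_nhds h] with s hs
          simp [indicator, hs]
        exact continuousAt_const.congr this
  have hz : ∀ S : Set (ℝ × E), MeasurableSet S → (∀ z ∈ S, g z = 0) → μ S = 0 := by
    intro S hS h
    rw [hμ, withDensity_apply _ hS, setLIntegral_congr_fun hS h]; simp
  set A := |R| + 1
  have hA : R < A := lt_of_le_of_lt (le_abs_self R) (lt_add_one _)
  have hA0 : 0 < A := by positivity
  have hlo : μ.real {z | z.1 ≤ -A} = 0 := by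
    rw [measureReal_def, hz _ (hms _) ?_]; · simp
    intro z hz
    apply hR
    have : z.1 ≤ -A := hz
    rw [abs_of_nonpos (by linarith)]; linarith
  have hhi : μ.real {z | z.1 ≤ A} = μ.real univ := by
    have : μ {z | z.1 ≤ A}ᶜ = 0 := by
      apply hz _ (hms _).compl
      intro z hz
      apply hR
      have : A < z.1 := by simpa using hz
      exact hA.trans (this.trans_le (le_abs_self _))
    rw [measureReal_def, measureReal_def, ← measure_add_measure_compl (hms A), this, add_zero]
  obtain ⟨r, -, hr⟩ := intermediate_value_Icc (a := -A) (b := A) (by linarith) hcont.continuousOn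
    (show μ.real univ / 2 ∈ _ by
      rw [hlo, hhi]; constructor <;> linarith [measureReal_nonneg (μ := μ) (s := univ)])
  have hl : μ {z | z.1 < r} = μ {z | z.1 ≤ r} := by
    refine measure_congr ?_
    filter_upwards [show ∀ᵐ z ∂μ, z.1 ≠ r by simpa [ae_iff] using hnull r] with z hz
    exact propext ⟨fun h : z.1 < r => le_of_lt h, fun h : z.1 ≤ r => lt_of_le_of_ne h hz⟩
  have hc : {z : ℝ × E | z.1 ≤ r}ᶜ = {z | r < z.1} := by ext z; simp
  have htot := measure_add_measure_compl (μ := μ) (hms r)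
  rw [hc] at htot
  have m1 : MeasurableSet {z : ℝ × E | r < z.1} := measurableSet_lt measurable_const measurable_fst
  have m2 : MeasurableSet {z : ℝ × E | z.1 < r} := measurableSet_lt measurable_fst measurable_const
  refine ⟨r, ?_, ?_⟩
  · rw [← withDensity_apply _ m1, ← withDensity_apply _ m2, ← hμ, hl]
    rw [← ENNReal.toReal_eq_toReal_iff' (measure_ne_top _ _) (measure_ne_top _ _)]
    have := congrArg ENNReal.toReal htot
    rw [ENNReal.toReal_add (measure_ne_top _ _) (measure_ne_top _ _)] at this
    simp only [measureReal_def] at hr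
    linarith
  · rw [← withDensity_apply _ m1, ← withDensity_apply _ m2, ← hμ, hl, add_comm, htot, hμ,
      withDensity_apply _ MeasurableSet.univ, Measure.restrict_univ]

theorem exists_line {E : Type*} [NormedAddCommGroup E] [NormedSpace ℝ E] [CompleteSpace E]
    [MeasurableSpace E]
    {μ : Measure (ℝ × E)} [IsFiniteMeasure μ] {r : ℝ}
    (h1 : Integrable (fun z : ℝ × E => z.1) μ) (h2 : Integrable (fun z : ℝ × E => z.2) μ)
    (heq : μ {z | r < z.1} = μ {z | z.1 < r}) (hne : μ {z | r < z.1} ≠ 0) :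
    ∃ p w : E, (∫ z in {z | r < z.1}, (z.2 - p - (z.1 - r) • w) ∂μ = 0) ∧
      (∫ z in {z | z.1 < r}, (z.2 - p - (z.1 - r) • w) ∂μ = 0) := by
  have m1 : MeasurableSet {z : ℝ × E | r < z.1} := measurableSet_lt measurable_const measurable_fst
  have m2 : MeasurableSet {z : ℝ × E | z.1 < r} := measurableSet_lt measurable_fst measurable_const
  have hir : Integrable (fun z : ℝ × E => z.1 - r) μ := h1.sub (integrable_const _)
  have hT1 : 0 < ∫ z in {z | r < z.1}, (z.1 - r) ∂μ := by
    rw [setIntegral_pos_iff_support_of_nonneg_ae]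
    · refine lt_of_lt_of_le (pos_iff_ne_zero.2 hne) (measure_mono ?_)
      intro z hz
      exact ⟨sub_ne_zero.2 (ne_of_gt hz), hz⟩
    · filter_upwards [ae_restrict_mem m1] with z hz
      exact sub_nonneg.2 (le_of_lt hz)
    · exact hir.integrableOn
  have hT2 : ∫ z in {z | z.1 < r}, (z.1 - r) ∂μ ≤ 0 := by
    refine setIntegral_nonpos m2 fun z hz => ?_
    have : z.1 < r := hz
    linarith
  have hgen : ∀ (S : Set (ℝ × E)) (p w : E), ∫ z in S, (z.2 - p - (z.1 - r) • w) ∂μ =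
      (∫ z in S, z.2 ∂μ) - μ.real S • p - (∫ z in S, (z.1 - r) ∂μ) • w := by
    intro S p w
    rw [integral_sub, integral_sub, integral_smul_const]
    · simp
    · exact h2.integrableOn
    · exact integrable_const _
    · exact (h2.sub (integrable_const p)).integrableOn
    · exact (hir.smul_const w).integrableOn
  have hA : μ.real {z | z.1 < r} = μ.real {z | r < z.1} := by simp [measureReal_def, heq]
  have hA0 : μ.real {z | r < z.1} ≠ 0 := by
    rw [measureReal_def]; exact (ENNReal.toReal_pos hne (measure_ne_top _ _)).ne'
  simp only [hgen, hA]
  generalize μ.real {z | r < z.1} = A at *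
  generalize (∫ z in {z : ℝ × E | r < z.1}, (z.1 - r) ∂μ) = T1 at *
  generalize (∫ z in {z : ℝ × E | z.1 < r}, (z.1 - r) ∂μ) = T2 at *
  generalize (∫ z in {z : ℝ × E | r < z.1}, z.2 ∂μ) = Y1 at *
  generalize (∫ z in {z : ℝ × E | z.1 < r}, z.2 ∂μ) = Y2 at *
  have hT : T1 - T2 ≠ 0 := by linarith
  refine ⟨A⁻¹ • (Y1 - T1 • ((T1 - T2)⁻¹ • (Y1 - Y2))), (T1 - T2)⁻¹ • (Y1 - Y2), ?_, ?_⟩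
  · rw [smul_inv_smul₀ hA0]; abel
  · rw [smul_inv_smul₀ hA0]
    have : (T1 - T2) • ((T1 - T2)⁻¹ • (Y1 - Y2)) = Y1 - Y2 := smul_inv_smul₀ hT _
    rw [sub_smul] at this
    set W := (T1 - T2)⁻¹ • (Y1 - Y2)
    calc Y2 - (Y1 - T1 • W) - T2 • W = (T1 • W - T2 • W) - (Y1 - Y2) := by abel
      _ = 0 := by rw [this, sub_self]

theorem measurable_dot {n : ℕ} (q : Fin n → ℝ) : Measurable fun z : Fin n → ℝ => q ⬝ᵥ z := by
  unfold dotProduct; fun_prop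

/-- the affine shear used for `g` -/
theorem mp_shear {n : ℕ} (ε r : ℝ) (hε : ε = 1 ∨ ε = -1) (p w : Fin n → ℝ) :
    MeasurePreserving (fun z : ℝ × (Fin n → ℝ) => (ε * z.1 + r, z.2 + (p + (ε * z.1) • w))) := by
  have h1 : MeasurePreserving (fun t : ℝ => ε * t + r) := by
    rcases hε with rfl | rfl
    · simpa using measurePreserving_add_right volume r
    · simpa [Function.comp_def] using
        (measurePreserving_add_right volume r).comp (Measure.measurePreserving_neg (volume : Measure ℝ))
  have := h1.skew_product (μc := (volume : Measure (Fin n → ℝ))) (μd := volume)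
    (g := fun t y => y + (p + (ε * t) • w)) (by fun_prop)
    (Filter.Eventually.of_forall fun t => (measurePreserving_add_right volume _).map_eq)
  exact this

/-- the linear shear used for `f` -/
theorem mp_shear' {n : ℕ} (ε : ℝ) (hε : ε = 1 ∨ ε = -1) (w : Fin n → ℝ) :
    MeasurePreserving (fun z : ℝ × (Fin n → ℝ) => (ε * z.1 - w ⬝ᵥ z.2, z.2)) := by
  have h1 : ∀ c : ℝ, MeasurePreserving (fun t : ℝ => ε * t - c) := by
    intro c
    rcases hε with rfl | rfl
    · simpa using measurePreserving_sub_right volume c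
    · simpa [Function.comp_def] using
        (measurePreserving_sub_right volume c).comp (Measure.measurePreserving_neg (volume : Measure ℝ))
  have hw := measurable_dot w
  have := (MeasurePreserving.id (volume : Measure (Fin n → ℝ))).skew_product
    (μc := (volume : Measure ℝ)) (μd := volume)
    (g := fun y t => ε * t - w ⬝ᵥ y) (by fun_prop)
    (Filter.Eventually.of_forall fun y => (h1 _).map_eq)
  exact (Measure.measurePreserving_swap.comp this).comp Measure.measurePreserving_swap

theorem one_side' {n : ℕ} (IH : FSant n) {f g : ℝ × (Fin n → ℝ) → ENNReal} (hf : Measurable f)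
    (hg : Measurable g) (c : ENNReal)
    (h : ∀ a b : ℝ × (Fin n → ℝ), f a * g b ≤
      c * ENNReal.ofReal (exp (-(a.1 * b.1 + a.2 ⬝ᵥ b.2))))
    (ε r : ℝ) (hε : ε = 1 ∨ ε = -1) (p w : Fin n → ℝ)
    (hC : ∀ q : Fin n → ℝ, ∫⁻ z in {z : ℝ × (Fin n → ℝ) | 0 < ε * (z.1 - r)}, g z ≤
      ∫⁻ z in {z : ℝ × (Fin n → ℝ) | 0 < ε * (z.1 - r)}, g z *
        ENNReal.ofReal (exp (q ⬝ᵥ (z.2 - p - (z.1 - r) • w)))) :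
    (∫⁻ z in {z : ℝ × (Fin n → ℝ) | 0 < ε * (z.1 + w ⬝ᵥ z.2)},
        f z * ENNReal.ofReal (exp (r * z.1 + p ⬝ᵥ z.2))) *
      (∫⁻ z in {z : ℝ × (Fin n → ℝ) | 0 < ε * (z.1 - r)}, g z) ≤
      c * ENNReal.ofReal (π / 2) * ENNReal.ofReal ((2 * π) ^ n) := by
  have hε2 : ε * ε = 1 := by rcases hε with rfl | rfl <;> norm_num
  have hw := measurable_dot w
  have hp := measurable_dot p
  have S1 : MeasurableSet {z : ℝ × (Fin n → ℝ) | 0 < ε * (z.1 - r)} :=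
    measurableSet_lt measurable_const (by fun_prop)
  have S2 : MeasurableSet {z : ℝ × (Fin n → ℝ) | 0 < ε * (z.1 + w ⬝ᵥ z.2)} :=
    measurableSet_lt measurable_const (by fun_prop)
  have P1 : (fun z : ℝ × (Fin n → ℝ) => (ε * z.1 + r, z.2 + (p + (ε * z.1) • w))) ⁻¹'
      {z : ℝ × (Fin n → ℝ) | 0 < ε * (z.1 - r)} = {z | 0 < z.1} := by
    ext z; simp [← mul_assoc, hε2]
  have P2 : (fun z : ℝ × (Fin n → ℝ) => (ε * z.1 - w ⬝ᵥ z.2, z.2)) ⁻¹'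
      {z : ℝ × (Fin n → ℝ) | 0 < ε * (z.1 + w ⬝ᵥ z.2)} = {z | 0 < z.1} := by
    ext z; simp [← mul_assoc, hε2]
  have I1 : ∀ φ : ℝ × (Fin n → ℝ) → ENNReal, Measurable φ →
      ∫⁻ z in {z : ℝ × (Fin n → ℝ) | 0 < ε * (z.1 - r)}, φ z =
      ∫⁻ z in {z : ℝ × (Fin n → ℝ) | 0 < z.1}, φ (ε * z.1 + r, z.2 + (p + (ε * z.1) • w)) := by
    intro φ hφ
    rw [← (mp_shear ε r hε p w).setLIntegral_comp_preimage S1 hφ, P1]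
  have I2 : ∀ φ : ℝ × (Fin n → ℝ) → ENNReal, Measurable φ →
      ∫⁻ z in {z : ℝ × (Fin n → ℝ) | 0 < ε * (z.1 + w ⬝ᵥ z.2)}, φ z =
      ∫⁻ z in {z : ℝ × (Fin n → ℝ) | 0 < z.1}, φ (ε * z.1 - w ⬝ᵥ z.2, z.2) := by
    intro φ hφ
    rw [← (mp_shear' ε hε w).setLIntegral_comp_preimage S2 hφ, P2]
  rw [I1 g hg, I2 _ (by fun_prop)]
  refine one_side IH (f := fun z => f (ε * z.1 - w ⬝ᵥ z.2, z.2) *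
      ENNReal.ofReal (exp (r * (ε * z.1 - w ⬝ᵥ z.2) + p ⬝ᵥ z.2)))
    (g := fun z => g (ε * z.1 + r, z.2 + (p + (ε * z.1) • w))) (by fun_prop) (by fun_prop) c ?_ ?_
  · intro s _ t _ x y
    have := h (ε * s - w ⬝ᵥ x, x) (ε * t + r, y + (p + (ε * t) • w))
    calc _ = f (ε * s - w ⬝ᵥ x, x) * g (ε * t + r, y + (p + (ε * t) • w)) *
          ENNReal.ofReal (exp (r * (ε * s - w ⬝ᵥ x) + p ⬝ᵥ x)) := by ring
      _ ≤ _ := mul_le_mul_left this _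
      _ = _ := by
        rw [mul_assoc, ← ENNReal.ofReal_mul (exp_pos _).le, ← Real.exp_add]
        congr 3
        simp only [dotProduct_add, dotProduct_smul, smul_eq_mul]
        rw [dotProduct_comm x p, dotProduct_comm x w]
        linear_combination (- s * t) * hε2
  · intro q
    have hq := measurable_dot q
    have := hC q
    rw [I1 g hg, I1 _ (by fun_prop)] at this
    refine this.trans (le_of_eq ?_)
    congr 1; ext z
    congr 4
    simp only [add_sub_cancel_right]
    abel

theorem step_bdd {n : ℕ} (IH : FSant n) {f g : ℝ × (Fin n → ℝ) → ENNReal} (hf : Measurable f)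
    (hg : Measurable g) (c : ENNReal)
    (h : ∀ a b : ℝ × (Fin n → ℝ), f a * g b ≤
      c * ENNReal.ofReal (exp (-(a.1 * b.1 + a.2 ⬝ᵥ b.2))))
    (hfin : ∫⁻ z, g z ≠ ⊤) {R : ℝ} (hR : ∀ z, R < ‖z‖ → g z = 0)
    (hC : ∀ (r : ℝ) (p : Fin n → ℝ), ∫⁻ z, f z ≤
      ∫⁻ z, f z * ENNReal.ofReal (exp (r * z.1 + p ⬝ᵥ z.2))) :
    (∫⁻ z, f z) * ∫⁻ z, g z ≤ c * ENNReal.ofReal ((2 * π) ^ (n + 1)) := by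
  obtain ⟨r, hr1, hr2⟩ := exists_median hg hfin (R := R)
    (fun z hz => hR z (hz.trans_le (by simpa using norm_fst_le z)))
  set μ : Measure (ℝ × (Fin n → ℝ)) := volume.withDensity g with hμ
  have hμfin : IsFiniteMeasure μ := isFiniteMeasure_withDensity hfin
  have m1 : MeasurableSet {z : ℝ × (Fin n → ℝ) | r < z.1} :=
    measurableSet_lt measurable_const measurable_fst
  have m2 : MeasurableSet {z : ℝ × (Fin n → ℝ) | z.1 < r} :=
    measurableSet_lt measurable_fst measurable_const
  by_cases hne : ∫⁻ z in {z : ℝ × (Fin n → ℝ) | r < z.1}, g z = 0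
  · rw [hr2, ← hr1, hne]; simp
  have hae : ∀ᵐ z ∂μ, ‖z‖ ≤ R := by
    have hS : MeasurableSet {z : ℝ × (Fin n → ℝ) | R < ‖z‖} :=
      measurableSet_lt measurable_const measurable_norm
    have : μ {z | R < ‖z‖} = 0 := by
      rw [hμ, withDensity_apply _ hS, setLIntegral_congr_fun hS hR]; simp
    simpa [ae_iff] using this
  have i1 : Integrable (fun z : ℝ × (Fin n → ℝ) => z.1) μ := by
    refine Integrable.of_bound measurable_fst.aestronglyMeasurable R ?_
    filter_upwards [hae] with z hz using (norm_fst_le z).trans hz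
  have i2 : Integrable (fun z : ℝ × (Fin n → ℝ) => z.2) μ := by
    refine Integrable.of_bound measurable_snd.aestronglyMeasurable R ?_
    filter_upwards [hae] with z hz using (norm_snd_le z).trans hz
  obtain ⟨p, w, hp1, hp2⟩ := exists_line (μ := μ) (r := r) i1 i2
    (by rwa [hμ, withDensity_apply _ m1, withDensity_apply _ m2])
    (by rwa [hμ, withDensity_apply _ m1])
  have i3 : Integrable (fun z : ℝ × (Fin n → ℝ) => z.2 - p - (z.1 - r) • w) μ :=
    (i2.sub (integrable_const p)).sub ((i1.sub (integrable_const r)).smul_const w)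
  have hJ : ∀ S : Set (ℝ × (Fin n → ℝ)), MeasurableSet S →
      ∫ z in S, (z.2 - p - (z.1 - r) • w) ∂μ = 0 → ∀ q : Fin n → ℝ,
      ∫⁻ z in S, g z ≤ ∫⁻ z in S, g z * ENNReal.ofReal (exp (q ⬝ᵥ (z.2 - p - (z.1 - r) • w))) := by
    intro S hS hz q
    have hq := measurable_dot q
    let L : (Fin n → ℝ) →L[ℝ] ℝ := LinearMap.toContinuousLinearMap
      { toFun := fun v => q ⬝ᵥ v
        map_add' := fun a b => dotProduct_add q a b
        map_smul' := fun a b => dotProduct_smul a q b }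
    have hi := L.integrable_comp (i3.integrableOn (s := S))
    have h0 := L.integral_comp_comm (i3.integrableOn (s := S))
    rw [hz, map_zero] at h0
    have := jensen_exp hi h0
    rw [Measure.restrict_apply_univ, hμ, withDensity_apply _ hS,
      restrict_withDensity hS, lintegral_withDensity_eq_lintegral_mul _ hg ?_] at this
    · exact this
    · change Measurable fun z : ℝ × (Fin n → ℝ) =>
        ENNReal.ofReal (exp (q ⬝ᵥ (z.2 - p - (z.1 - r) • w)))
      fun_prop
  have s1 : {z : ℝ × (Fin n → ℝ) | 0 < (1 : ℝ) * (z.1 - r)} = {z | r < z.1} := by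
    ext z; simp
  have s2 : {z : ℝ × (Fin n → ℝ) | 0 < (-1 : ℝ) * (z.1 - r)} = {z | z.1 < r} := by
    ext z; simp
  have k1 := one_side' IH hf hg c h 1 r (Or.inl rfl) p w (by rw [s1]; exact hJ _ m1 hp1)
  have k2 := one_side' IH hf hg c h (-1) r (Or.inr rfl) p w (by rw [s2]; exact hJ _ m2 hp2)
  rw [s1] at k1
  rw [s2] at k2
  have hw := measurable_dot w
  have hp := measurable_dot p
  -- splitting the integral of `f`
  have hsplit : ∫⁻ z, f z * ENNReal.ofReal (exp (r * z.1 + p ⬝ᵥ z.2)) ≤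
      (∫⁻ z in {z : ℝ × (Fin n → ℝ) | 0 < (1 : ℝ) * (z.1 + w ⬝ᵥ z.2)},
        f z * ENNReal.ofReal (exp (r * z.1 + p ⬝ᵥ z.2))) +
      ∫⁻ z in {z : ℝ × (Fin n → ℝ) | 0 < (-1 : ℝ) * (z.1 + w ⬝ᵥ z.2)},
        f z * ENNReal.ofReal (exp (r * z.1 + p ⬝ᵥ z.2)) := by
    have hnull : volume {z : ℝ × (Fin n → ℝ) | z.1 + w ⬝ᵥ z.2 = 0} = 0 := by
      have hm : MeasurableSet {z : ℝ × (Fin n → ℝ) | z.1 + w ⬝ᵥ z.2 = 0} :=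
        measurableSet_eq_fun (by fun_prop) measurable_const
      rw [← (mp_shear' 1 (Or.inl rfl) w).measure_preimage hm.nullMeasurableSet]
      have : (fun z : ℝ × (Fin n → ℝ) => (1 * z.1 - w ⬝ᵥ z.2, z.2)) ⁻¹'
          {z : ℝ × (Fin n → ℝ) | z.1 + w ⬝ᵥ z.2 = 0} = {0} ×ˢ univ := by
        ext z; simp
      rw [this, Measure.volume_eq_prod, Measure.prod_prod]; simp
    rw [← setLIntegral_univ]
    refine le_trans ?_ (lintegral_union_le _ _ _)
    refine le_of_eq (setLIntegral_congr ?_)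
    filter_upwards [show ∀ᵐ z : ℝ × (Fin n → ℝ), z.1 + w ⬝ᵥ z.2 ≠ 0 by
      simpa [ae_iff] using hnull] with z hz
    refine propext ⟨fun _ => ?_, fun _ => trivial⟩
    rcases lt_or_gt_of_ne hz with h | h
    · right; change 0 < (-1 : ℝ) * (z.1 + w ⬝ᵥ z.2); linarith
    · left; change 0 < (1 : ℝ) * (z.1 + w ⬝ᵥ z.2); linarith
  have hfin := (hC r p).trans hsplit
  rw [← hr1] at k2 hr2
  generalize (∫⁻ z in {z : ℝ × (Fin n → ℝ) | r < z.1}, g z) = G at *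
  rw [hr2]
  refine (mul_le_mul_left hfin _).trans ?_
  calc _ ≤ 2 * (c * ENNReal.ofReal (π / 2) * ENNReal.ofReal ((2 * π) ^ n)) +
        2 * (c * ENNReal.ofReal (π / 2) * ENNReal.ofReal ((2 * π) ^ n)) := by
        refine le_trans (le_of_eq ?_) (add_le_add (mul_le_mul_right k1 2) (mul_le_mul_right k2 2))
        ring
    _ = c * (ENNReal.ofReal 4 * ENNReal.ofReal (π / 2) * ENNReal.ofReal ((2 * π) ^ n)) := by
        rw [show (4 : ℝ) = (4 : ℕ) by norm_num, ENNReal.ofReal_natCast]; push_cast; ring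
    _ = _ := by
        rw [← ENNReal.ofReal_mul (by norm_num), ← ENNReal.ofReal_mul (by positivity)]
        congr 2; ring

theorem FSant_succ {n : ℕ} (IH : FSant n) : FSant (n + 1) := by
  intro f g c hf hg hC h
  let e := MeasurableEquiv.piFinSuccAbove (fun _ : Fin (n + 1) => ℝ) 0
  have he : MeasurePreserving e.symm :=
    (volume_preserving_piFinSuccAbove (fun _ : Fin (n + 1) => ℝ) 0).symm
  have hdot : ∀ a b : ℝ × (Fin n → ℝ), e.symm a ⬝ᵥ e.symm b = a.1 * b.1 + a.2 ⬝ᵥ b.2 := by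
    intro a b
    simp [e, dotProduct, Fin.sum_univ_succ, MeasurableEquiv.piFinSuccAbove]
  have hIntg : ∀ φ : (Fin (n + 1) → ℝ) → ENNReal, ∫⁻ x, φ x = ∫⁻ z, φ (e.symm z) := by
    intro φ
    exact (he.lintegral_comp_emb e.symm.measurableEmbedding φ).symm
  rw [hIntg f, hIntg g]
  -- truncation of g
  let gk : ℕ → ℝ × (Fin n → ℝ) → ENNReal := fun k =>
    indicator (closedBall 0 (k : ℝ)) (fun z => min (g (e.symm z)) k)
  have hgm : Measurable fun z => g (e.symm z) := hg.comp e.symm.measurable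
  have hfm : Measurable fun z => f (e.symm z) := hf.comp e.symm.measurable
  have hgk : ∀ k, Measurable (gk k) := fun k =>
    (hgm.min measurable_const).indicator isClosed_closedBall.measurableSet
  have hle : ∀ k z, gk k z ≤ g (e.symm z) := by
    intro k z
    simp only [gk, indicator]
    split_ifs
    · exact min_le_left _ _
    · exact zero_le
  have hsup : ∫⁻ z, g (e.symm z) = ⨆ k, ∫⁻ z, gk k z := by
    rw [← lintegral_iSup hgk]
    · congr 1; ext z
      apply le_antisymm
      · refine le_of_forall_lt fun c hc => ?_
        obtain ⟨k, hk⟩ := ENNReal.exists_nat_gt (ne_top_of_lt hc)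
        obtain ⟨l, hl⟩ := exists_nat_ge ‖z‖
        refine lt_of_lt_of_le ?_ (le_iSup (fun k : ℕ => gk k z) (max k l))
        have : z ∈ closedBall (0 : ℝ × (Fin n → ℝ)) ((max k l : ℕ) : ℝ) := by
          rw [mem_closedBall_zero_iff]
          exact hl.trans (by exact_mod_cast le_max_right k l)
        simp only [gk, indicator, this, if_true]
        refine lt_min hc (hk.trans_le (by exact_mod_cast le_max_left k l))
      · exact iSup_le fun k => hle k z
    · intro i j hij z
      simp only [gk]
      have hij' : (i : ℝ) ≤ j := by exact_mod_cast hij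
      refine (indicator_le_indicator_of_subset (closedBall_subset_closedBall hij') 
        (fun _ => zero_le) z).trans (indicator_le_indicator ?_)
      exact min_le_min_left _ (by exact_mod_cast hij)
  rw [hsup, ENNReal.mul_iSup]
  refine iSup_le fun k => ?_
  refine step_bdd IH hfm (hgk k) c ?_ ?_ (R := k) ?_ ?_
  · intro a b
    rw [← hdot]
    exact (mul_le_mul_right (hle k b) _).trans (h _ _)
  · have : ∫⁻ z, gk k z ≤ k * volume (closedBall (0 : ℝ × (Fin n → ℝ)) (k : ℝ)) := by
      simp only [gk]
      rw [lintegral_indicator isClosed_closedBall.measurableSet, ← setLIntegral_const]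
      exact lintegral_mono fun z => min_le_right _ _
    refine ne_top_of_le_ne_top ?_ this
    exact ENNReal.mul_ne_top (by simp) (measure_closedBall_lt_top).ne
  · intro z hz
    simp [gk, hz]
  · intro r p
    have := hC (e.symm (r, p))
    rw [hIntg f, hIntg] at this
    simpa only [hdot] using this

theorem FSant_all (n : ℕ) : FSant n := by
  induction n with
  | zero => exact FSant_zero
  | succ n ih => exact FSant_succ ih

theorem lintegral_scale {E : Type*} [NormedAddCommGroup E] [NormedSpace ℝ E] [MeasurableSpace E]
    [BorelSpace E] [FiniteDimensional ℝ E] (μ : Measure E) [μ.IsAddHaarMeasure] {s : ℝ}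
    (hs : 0 < s) {S : Set E} (hS : MeasurableSet S) {φ : E → ENNReal} (hφ : Measurable φ) :
    ∫⁻ x in s • S, φ x ∂μ =
      ENNReal.ofReal (s ^ Module.finrank ℝ E) * ∫⁻ x in S, φ (s • x) ∂μ := by
  have h1 := setLIntegral_map (μ := μ) (hS.const_smul₀ s) hφ
    (measurable_const_smul s : Measurable fun x : E => s • x)
  rw [Measure.map_addHaar_smul μ hs.ne', Measure.restrict_smul, lintegral_smul_measure] at h1
  have h2 : (fun x : E => s • x) ⁻¹' (s • S) = S := by
    ext x; simp [Set.smul_mem_smul_set_iff₀ hs.ne']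
  rw [h2] at h1
  rw [← h1, smul_eq_mul, ← mul_assoc, ← ENNReal.ofReal_mul (by positivity),
    abs_of_pos (by positivity), mul_inv_cancel₀ (by positivity)]
  simp

theorem lintegral_polar {n : ℕ} (hn : 1 ≤ n) {ψ : EuclideanSpace ℝ (Fin n) → ENNReal}
    (hψ : Measurable ψ) :
    ∫⁻ x, ψ x = ∫⁻ u, (∫⁻ r in Ioi (0 : ℝ), ENNReal.ofReal (r ^ (n - 1)) *
      ψ (r • (u : EuclideanSpace ℝ (Fin n)))) ∂(sphMeasure n) := by
  have : Nonempty (Fin n) := ⟨⟨0, hn⟩⟩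
  have hmp := (volume : Measure (EuclideanSpace ℝ (Fin n))).measurePreserving_homeomorphUnitSphereProd
  have h1 : ∫⁻ x, ψ x = ∫⁻ x : ({(0 : EuclideanSpace ℝ (Fin n))}ᶜ : Set _), ψ x
      ∂((volume : Measure (EuclideanSpace ℝ (Fin n))).comap (↑)) := by
    rw [lintegral_subtype_comap (measurableSet_singleton _).compl ψ, restrict_compl_singleton]
  have h2 := hmp.lintegral_comp_emb (Homeomorph.measurableEmbedding _)
    (fun z => ψ ((z.2 : ℝ) • (z.1 : EuclideanSpace ℝ (Fin n))))
  have h3 : ∀ a : ({(0 : EuclideanSpace ℝ (Fin n))}ᶜ : Set _),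
      (((homeomorphUnitSphereProd (EuclideanSpace ℝ (Fin n)) a).2 : ℝ) •
      ((homeomorphUnitSphereProd (EuclideanSpace ℝ (Fin n)) a).1 : EuclideanSpace ℝ (Fin n))) = a := by
    intro a
    have ha : ‖(a : EuclideanSpace ℝ (Fin n))‖ ≠ 0 := norm_ne_zero_iff.2 a.2
    simp [smul_smul, ha]
  simp only [h3] at h2
  rw [h1, h2, lintegral_prod _ (by fun_prop)]
  simp only [finrank_euclideanSpace, Fintype.card_fin]
  unfold sphMeasure
  congr 1; ext u
  rw [Measure.volumeIoiPow, lintegral_withDensity_eq_lintegral_mul _ (by fun_prop) (by fun_prop),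
    ← lintegral_subtype_comap measurableSet_Ioi]
  rfl

theorem radial {n : ℕ} (hn : 1 ≤ n) {h : ℝ} (hh : 0 < h) :
    ∫⁻ r in Ioi (0 : ℝ), ENNReal.ofReal (r ^ (n - 1)) * ENNReal.ofReal (exp (-((r * h) ^ 2 / 2))) =
    ENNReal.ofReal (h ^ (-(n : ℝ))) *
    ∫⁻ r in Ioi (0 : ℝ), ENNReal.ofReal (r ^ (n - 1)) * ENNReal.ofReal (exp (-(r ^ 2 / 2))) := by
  have hi : 0 < h⁻¹ := by positivity
  have := lintegral_scale (volume : Measure ℝ) hi (measurableSet_Ioi (a := (0 : ℝ)))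
    (φ := fun r => ENNReal.ofReal (r ^ (n - 1)) * ENNReal.ofReal (exp (-((r * h) ^ 2 / 2))))
    (by fun_prop)
  rw [LinearOrderedField.smul_Ioi hi, mul_zero] at this
  rw [this, ← lintegral_const_mul _ (by fun_prop), ← lintegral_const_mul _ (by fun_prop)]
  refine setLIntegral_congr_fun measurableSet_Ioi fun r hr => ?_
  have hr0 : 0 < r := hr
  have e : h⁻¹ * r * h = r := by field_simp
  simp only [smul_eq_mul, e, Module.finrank_self, pow_one]
  rw [← mul_assoc, ← mul_assoc, ← ENNReal.ofReal_mul hi.le, ← ENNReal.ofReal_mul (by positivity)]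
  rw [mul_pow, ← mul_assoc, ← pow_succ', Nat.sub_add_cancel hn, Real.rpow_neg hh.le,
    Real.rpow_natCast, inv_pow]
  rw [ENNReal.ofReal_mul (by positivity), ENNReal.ofReal_mul (by positivity)]

theorem gauss_tail {q : ℝ} (hq : 0 ≤ q) :
    ∫⁻ s in Ioi q, ENNReal.ofReal (s * exp (-(s ^ 2 / 2))) = ENNReal.ofReal (exp (-(q ^ 2 / 2))) := by
  have hd : ∀ x ∈ Ici q, HasDerivAt (fun s : ℝ => -exp (-(s ^ 2 / 2))) (x * exp (-(x ^ 2 / 2))) x := by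
    intro x _
    have h1 : HasDerivAt (fun s : ℝ => -(s ^ 2 / 2)) (-x) x := by
      exact (((hasDerivAt_pow 2 x).div_const 2).neg).congr_deriv (by norm_num)
    exact (h1.exp.neg).congr_deriv (by ring)
  have hlim : Filter.Tendsto (fun s : ℝ => -exp (-(s ^ 2 / 2))) Filter.atTop (nhds 0) := by
    rw [← neg_zero]
    refine Filter.Tendsto.neg (Real.tendsto_exp_neg_atTop_nhds_zero.comp ?_)
    exact (Filter.tendsto_pow_atTop two_ne_zero).atTop_div_const two_pos
  have hpos : ∀ x ∈ Ioi q, 0 ≤ x * exp (-(x ^ 2 / 2)) := fun x hx =>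
    mul_nonneg (hq.trans (le_of_lt hx)) (exp_pos _).le
  have hIntg := integrableOn_Ioi_deriv_of_nonneg' hd hpos hlim
  have hval := integral_Ioi_of_hasDerivAt_of_nonneg' hd hpos hlim
  rw [← ofReal_integral_eq_lintegral_ofReal hIntg, hval]
  · simp
  · filter_upwards [ae_restrict_mem measurableSet_Ioi] with x hx using hpos x hx

theorem layer {n : ℕ} {L : Set (EuclideanSpace ℝ (Fin n))} (hL : Convex ℝ L)
    (h0 : L ∈ nhds 0) {φ : EuclideanSpace ℝ (Fin n) → ENNReal}
    (hφ : Measurable φ) :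
    ∫⁻ x, ENNReal.ofReal (exp (-(gauge L x ^ 2 / 2))) * φ x =
      ∫⁻ s in Ioi (0 : ℝ), ENNReal.ofReal (s * exp (-(s ^ 2 / 2))) * (ENNReal.ofReal (s ^ n) *
        ∫⁻ x in L, φ (s • x)) := by
  have hgm : Measurable (gauge L) := (continuous_gauge hL h0).measurable
  have hset : MeasurableSet {z : EuclideanSpace ℝ (Fin n) × ℝ | gauge L z.1 < z.2} :=
    measurableSet_lt (by fun_prop) measurable_snd
  have h1 : ∀ x, ENNReal.ofReal (exp (-(gauge L x ^ 2 / 2))) * φ x =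
      ∫⁻ s in Ioi (0 : ℝ), indicator {z : EuclideanSpace ℝ (Fin n) × ℝ | gauge L z.1 < z.2}
        (fun z => ENNReal.ofReal (z.2 * exp (-(z.2 ^ 2 / 2))) * φ z.1) (x, s) := by
    intro x
    rw [← gauss_tail (gauge_nonneg x), ← lintegral_mul_const _ (by fun_prop)]
    have : ∀ s : ℝ, indicator {z : EuclideanSpace ℝ (Fin n) × ℝ | gauge L z.1 < z.2}
        (fun z => ENNReal.ofReal (z.2 * exp (-(z.2 ^ 2 / 2))) * φ z.1) (x, s) =
        indicator (Ioi (gauge L x)) (fun s => ENNReal.ofReal (s * exp (-(s ^ 2 / 2))) * φ x) s := by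
      intro s; simp [indicator]
    simp_rw [this]
    rw [setLIntegral_indicator measurableSet_Ioi]
    congr 2
    ext s
    simp only [mem_Ioi, mem_inter_iff]
    exact ⟨fun h => ⟨h, (gauge_nonneg x).trans_lt h⟩, fun h => h.1⟩
  simp_rw [h1]
  rw [lintegral_lintegral_swap]
  · refine setLIntegral_congr_fun measurableSet_Ioi fun s hs => ?_
    have hs0 : 0 < s := hs
    have hae : (interior L : Set _) =ᵐ[volume] L := by
      have := hL.addHaar_frontier (volume : Measure (EuclideanSpace ℝ (Fin n)))
      exact interior_ae_eq_of_null_frontier this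
    have e1 : {x | gauge L x < s} = s • interior L := by
      ext x
      rw [Set.mem_smul_set_iff_inv_smul_mem₀ hs0.ne', ← gauge_lt_one_iff_mem_interior hL h0,
        gauge_smul_of_nonneg (by positivity : (0 : ℝ) ≤ s⁻¹), smul_eq_mul, inv_mul_lt_one₀ hs0]
      rfl
    have e2 := lintegral_scale (volume : Measure (EuclideanSpace ℝ (Fin n))) hs0
      (isOpen_interior (s := L)).measurableSet hφ
    simp only [finrank_euclideanSpace, Fintype.card_fin] at e2
    rw [setLIntegral_congr hae] at e2
    rw [← e2, ← e1]
    have : ∀ x, indicator {z : EuclideanSpace ℝ (Fin n) × ℝ | gauge L z.1 < z.2}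
        (fun z => ENNReal.ofReal (z.2 * exp (-(z.2 ^ 2 / 2))) * φ z.1) (x, s) =
        indicator {x | gauge L x < s} (fun x => ENNReal.ofReal (s * exp (-(s ^ 2 / 2))) * φ x) x := by
      intro x; simp [indicator]
    simp_rw [this]
    have hm : MeasurableSet {x | gauge L x < s} := measurableSet_lt hgm measurable_const
    rw [lintegral_indicator hm, lintegral_const_mul _ hφ]
  · refine Measurable.aemeasurable ?_
    exact Measurable.indicator (by fun_prop) hset

theorem FSant_eucl (n : ℕ) {f g : EuclideanSpace ℝ (Fin n) → ENNReal} (hf : Measurable f)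
    (hg : Measurable g)
    (hC : ∀ z, ∫⁻ x, f x ≤ ∫⁻ x, f x * ENNReal.ofReal (exp ⟪z, x⟫))
    (h : ∀ x y, f x * g y ≤ ENNReal.ofReal (exp (-⟪x, y⟫))) :
    (∫⁻ x, f x) * ∫⁻ y, g y ≤ ENNReal.ofReal ((2 * π) ^ n) := by
  let e := MeasurableEquiv.toLp 2 (Fin n → ℝ)
  have he : MeasurePreserving e := PiLp.volume_preserving_toLp (Fin n)
  have hIntg : ∀ φ : EuclideanSpace ℝ (Fin n) → ENNReal, ∫⁻ x, φ x = ∫⁻ z, φ (e z) := fun φ =>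
    (he.lintegral_comp_emb e.measurableEmbedding φ).symm
  have hdot : ∀ a b : Fin n → ℝ, ⟪e a, e b⟫ = a ⬝ᵥ b := by
    intro a b
    simp [e, PiLp.inner_apply, dotProduct, mul_comm]
  rw [hIntg f, hIntg g]
  have := FSant_all n (fun z => f (e z)) (fun z => g (e z)) 1 (hf.comp e.measurable)
    (hg.comp e.measurable) (by
      intro z
      have := hC (e z)
      rw [hIntg f, hIntg] at this
      simpa only [hdot] using this)
    (by
      intro x y
      rw [one_mul, ← hdot]; exact h _ _)
  simpa using this

theorem supp_cont {n : ℕ} {L : Set (EuclideanSpace ℝ (Fin n))} (hc : IsCompact L) :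
    Continuous (supp L) := by
  unfold supp
  exact hc.continuous_sSup (f := fun u x => ⟪x, u⟫) (by
    change Continuous fun z : EuclideanSpace ℝ (Fin n) × EuclideanSpace ℝ (Fin n) => ⟪z.2, z.1⟫
    fun_prop)

theorem le_supp {n : ℕ} {L : Set (EuclideanSpace ℝ (Fin n))} (hc : IsCompact L)
    {x : EuclideanSpace ℝ (Fin n)} (hx : x ∈ L) (u : EuclideanSpace ℝ (Fin n)) :
    ⟪x, u⟫ ≤ supp L u := by
  refine le_csSup ?_ (mem_image_of_mem _ hx)
  exact (hc.image (f := fun x => ⟪x, u⟫) (by fun_prop)).bddAbove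

theorem supp_smul {n : ℕ} (L : Set (EuclideanSpace ℝ (Fin n)))
    (u : EuclideanSpace ℝ (Fin n)) {r : ℝ} (hr : 0 ≤ r) : supp L (r • u) = r * supp L u := by
  unfold supp
  rw [← smul_eq_mul r, ← Real.sSup_smul_of_nonneg hr, ← image_smul, image_image]
  simp [inner_smul_right]

theorem supp_pos {n : ℕ} {L : Set (EuclideanSpace ℝ (Fin n))} (hc : IsCompact L)
    (h0 : L ∈ nhds 0) {u : EuclideanSpace ℝ (Fin n)} (hu : u ≠ 0) : 0 < supp L u := by
  have h1 : Filter.Tendsto (fun t : ℝ => t • u) (nhdsWithin 0 (Ioi 0)) (nhds 0) := by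
    have : Filter.Tendsto (fun t : ℝ => t • u) (nhds 0) (nhds ((0 : ℝ) • u)) :=
      (continuous_id.smul continuous_const).tendsto _
    rw [zero_smul] at this
    exact this.mono_left nhdsWithin_le_nhds
  obtain ⟨t, htL, ht⟩ := ((h1.eventually h0).and self_mem_nhdsWithin).exists
  have ht0 : 0 < t := ht
  refine lt_of_lt_of_le ?_ (le_supp hc htL u)
  rw [real_inner_smul_left, real_inner_self_eq_norm_sq]
  have := norm_pos_iff.2 hu
  positivity

theorem gauss_total (n : ℕ) :
    (∫⁻ x : EuclideanSpace ℝ (Fin n), ENNReal.ofReal (exp (-(‖x‖ ^ 2 / 2)))) ^ 2 =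
      ENNReal.ofReal ((2 * π) ^ n) := by
  have h := GaussianFourier.integral_rexp_neg_mul_sq_norm (V := EuclideanSpace ℝ (Fin n))
    (b := 1 / 2) (by norm_num)
  have e : ∀ x : EuclideanSpace ℝ (Fin n), -(‖x‖ ^ 2 / 2) = -(1 / 2) * ‖x‖ ^ 2 := by intro x; ring
  simp_rw [e]
  have hv : 0 < (π / (1 / 2)) ^ (Module.finrank ℝ (EuclideanSpace ℝ (Fin n)) / 2 : ℝ) := by
    positivity
  have hIntg : Integrable fun x : EuclideanSpace ℝ (Fin n) => exp (-(1 / 2) * ‖x‖ ^ 2) := by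
    by_contra hni
    rw [integral_undef hni] at h
    exact hv.ne h
  rw [← ofReal_integral_eq_lintegral_ofReal hIntg
    (Filter.Eventually.of_forall fun x => (exp_pos _).le), h, ← ENNReal.ofReal_pow hv.le]
  congr 1
  rw [finrank_euclideanSpace, Fintype.card_fin, ← Real.rpow_mul_natCast (by positivity)]
  rw [show π / (1 / 2) = 2 * π by ring, show (n : ℝ) / 2 * (2 : ℕ) = n by push_cast; ring,
    Real.rpow_natCast]

theorem core {n : ℕ} (hn : 1 ≤ n) {L : Set (EuclideanSpace ℝ (Fin n))} (hc : IsCompact L)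
    (hL : Convex ℝ L) (h0 : L ∈ nhds 0) (hbar : ∫ x in L, x = 0)
    (hvol : volume L = volume (closedBall (0 : EuclideanSpace ℝ (Fin n)) 1)) :
    ∫⁻ u, ENNReal.ofReal (supp L (u : EuclideanSpace ℝ (Fin n)) ^ (-(n : ℝ))) ∂(sphMeasure n) ≤
      sphMeasure n univ := by
  have hgm : Measurable (gauge L) := (continuous_gauge hL h0).measurable
  have hsm : Measurable (supp L) := (supp_cont hc).measurable
  have hLfin : IsFiniteMeasure ((volume : Measure (EuclideanSpace ℝ (Fin n))).restrict L) :=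
    ⟨by rw [Measure.restrict_apply_univ]; exact hc.measure_lt_top⟩
  have hid : IntegrableOn (fun x : EuclideanSpace ℝ (Fin n) => x) L :=
    continuous_id.continuousOn.integrableOn_compact hc
  -- the functional inequality
  have key := FSant_eucl n (f := fun x => ENNReal.ofReal (exp (-(gauge L x ^ 2 / 2))))
    (g := fun y => ENNReal.ofReal (exp (-(supp L y ^ 2 / 2)))) (by fun_prop) (by fun_prop)
    (by
      intro z
      have e1 := layer hL h0 (φ := fun _ => 1) measurable_const
      simp only [mul_one] at e1
      rw [e1, layer hL h0 (by fun_prop)]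
      refine lintegral_mono fun s => ?_
      refine mul_le_mul_right (mul_le_mul_right ?_ _) _
      rw [lintegral_const, one_mul]
      refine jensen_exp ?_ ?_
      · simp only [inner_smul_right]
        exact (hid.const_inner z).const_mul s
      · simp only [inner_smul_right]
        rw [integral_const_mul, integral_inner hid, hbar]; simp)
    (by
      intro x y
      rw [← ENNReal.ofReal_mul (exp_pos _).le, ← Real.exp_add]
      refine ENNReal.ofReal_le_ofReal (Real.exp_le_exp.2 ?_)
      have hin : ⟪x, y⟫ ≤ gauge L x * supp L y := by
        have hs0 : 0 ≤ supp L y := by simpa using le_supp hc (mem_of_mem_nhds h0) y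
        refine le_of_forall_gt_imp_ge_of_dense fun t ht => ?_
        by_contra hcon
        push Not at hcon
        have : ∀ s, gauge L x < s → ⟪x, y⟫ ≤ s * supp L y := by
          intro s hs
          have hs' : 0 < s := (gauge_nonneg x).trans_lt hs
          have hmem : s⁻¹ • x ∈ L := by
            apply interior_subset
            rw [← gauge_lt_one_iff_mem_interior hL h0,
              gauge_smul_of_nonneg (by positivity : (0 : ℝ) ≤ s⁻¹), smul_eq_mul, inv_mul_lt_one₀ hs']
            exact hs
          have := le_supp hc hmem y
          rwa [real_inner_smul_left, inv_mul_le_iff₀ hs'] at this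
        have hlim : ⟪x, y⟫ ≤ gauge L x * supp L y := by
          refine ge_of_tendsto (f := fun s : ℝ => s * supp L y)
            (x := nhdsWithin (gauge L x) (Ioi (gauge L x))) ?_ ?_
          · exact ((continuous_id.mul continuous_const).tendsto _).mono_left nhdsWithin_le_nhds
          · filter_upwards [self_mem_nhdsWithin] with s hs using this s hs
        linarith
      nlinarith [sq_nonneg (gauge L x - supp L y)])
  -- the total mass of `f` is that of the Gaussian
  have hfI : ∫⁻ x, ENNReal.ofReal (exp (-(gauge L x ^ 2 / 2))) =
      ∫⁻ x : EuclideanSpace ℝ (Fin n), ENNReal.ofReal (exp (-(‖x‖ ^ 2 / 2))) := by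
    have e1 := layer hL h0 (φ := fun _ => 1) measurable_const
    have e2 := layer (n := n) (convex_closedBall (0 : EuclideanSpace ℝ (Fin n)) 1)
      (closedBall_mem_nhds _ one_pos) (φ := fun _ => 1) measurable_const
    simp only [mul_one, gauge_closedBall zero_le_one, div_one, lintegral_const, one_mul,
      Measure.restrict_apply_univ] at e1 e2
    rw [e1, e2, hvol]
  rw [hfI, ← gauss_total, sq] at key
  set I := ∫⁻ x : EuclideanSpace ℝ (Fin n), ENNReal.ofReal (exp (-(‖x‖ ^ 2 / 2))) with hI
  have hI2 := gauss_total n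
  rw [← hI] at hI2
  have hI0 : I ≠ 0 := by
    intro h
    rw [h] at hI2
    have : 0 < ENNReal.ofReal ((2 * π) ^ n) := ENNReal.ofReal_pos.2 (by positivity)
    rw [← hI2] at this
    simp at this
  have hIt : I ≠ ⊤ := by
    intro h
    rw [h] at hI2
    simp at hI2
  have key2 := (ENNReal.mul_le_mul_iff_right hI0 hIt).1 key
  -- polar coordinates
  set c := ∫⁻ r in Ioi (0 : ℝ), ENNReal.ofReal (r ^ (n - 1)) *
    ENNReal.ofReal (exp (-(r ^ 2 / 2))) with hcdef
  have p1 : ∫⁻ y, ENNReal.ofReal (exp (-(supp L y ^ 2 / 2))) =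
      (∫⁻ u, ENNReal.ofReal (supp L (u : EuclideanSpace ℝ (Fin n)) ^ (-(n : ℝ)))
        ∂(sphMeasure n)) * c := by
    rw [lintegral_polar hn (by fun_prop), ← lintegral_mul_const _ (by fun_prop)]
    congr 1; ext u
    have hu : (u : EuclideanSpace ℝ (Fin n)) ≠ 0 := ne_zero_of_mem_unit_sphere u
    rw [← radial hn (supp_pos hc h0 hu)]
    refine setLIntegral_congr_fun measurableSet_Ioi fun r hr => ?_
    simp only [supp_smul L _ (le_of_lt hr)]
  have p2 : I = sphMeasure n univ * c := by
    rw [hI, lintegral_polar hn (by fun_prop)]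
    have : ∀ u : sphere (0 : EuclideanSpace ℝ (Fin n)) 1,
        (∫⁻ r in Ioi (0 : ℝ), ENNReal.ofReal (r ^ (n - 1)) *
        ENNReal.ofReal (exp (-(‖r • (u : EuclideanSpace ℝ (Fin n))‖ ^ 2 / 2)))) = c := by
      intro u
      refine setLIntegral_congr_fun measurableSet_Ioi fun r hr => ?_
      simp [norm_smul]
    simp_rw [this]
    rw [lintegral_const, mul_comm]
  rw [p1, p2] at key2
  have hc0 : c ≠ 0 := by
    intro h; rw [h] at p2; simp at p2; exact hI0 p2
  have hct : c ≠ ⊤ := by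
    intro h; rw [h] at p2
    by_cases hs : sphMeasure n univ = 0
    · rw [hs, zero_mul] at p2; exact hI0 p2
    · rw [ENNReal.mul_top hs] at p2; exact hIt p2
  exact (ENNReal.mul_le_mul_iff_left hc0 hct).1 key2

theorem centroid_mem {n : ℕ} {K : Set (EuclideanSpace ℝ (Fin n))} (hK : IsConvexBody K) :
    ∃ x₀ ∈ interior K, ∫ x in K, (x - x₀) = 0 := by
  obtain ⟨hc, hL, hi⟩ := hK
  have hid : IntegrableOn (fun x : EuclideanSpace ℝ (Fin n) => x) K :=
    continuous_id.continuousOn.integrableOn_compact hc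
  have hKpos : 0 < volume K :=
    lt_of_lt_of_le (isOpen_interior.measure_pos volume hi) (measure_mono interior_subset)
  have hfin : IsFiniteMeasure ((volume : Measure (EuclideanSpace ℝ (Fin n))).restrict K) :=
    ⟨by rw [Measure.restrict_apply_univ]; exact hc.measure_lt_top⟩
  have hv : (volume : Measure (EuclideanSpace ℝ (Fin n))).real K ≠ 0 :=
    (ENNReal.toReal_pos hKpos.ne' hc.measure_lt_top.ne).ne'
  have hz : ∫ x in K, (x - ((volume : Measure (EuclideanSpace ℝ (Fin n))).real K)⁻¹ •
      ∫ x in K, x) = 0 := by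
    rw [integral_sub hid (integrable_const _), integral_const]
    simp [smul_smul, hv]
  refine ⟨_, ?_, hz⟩
  generalize ((volume : Measure (EuclideanSpace ℝ (Fin n))).real K)⁻¹ • ∫ x in K, x = x₀ at *
  by_contra hx
  obtain ⟨l, hl⟩ := geometric_hahn_banach_open_point hL.interior isOpen_interior hx
  have hae : (interior K : Set _) =ᵐ[volume] K :=
    interior_ae_eq_of_null_frontier
      (hL.addHaar_frontier (volume : Measure (EuclideanSpace ℝ (Fin n))))
  have hIntg : IntegrableOn (fun x : EuclideanSpace ℝ (Fin n) => x - x₀) K :=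
    hid.sub (integrable_const _)
  have h1 := l.integral_comp_comm hIntg
  rw [hz, map_zero, ← setIntegral_congr_set hae] at h1
  have h2 : 0 < ∫ x in interior K, -(l (x - x₀)) := by
    rw [setIntegral_pos_iff_support_of_nonneg_ae]
    · refine lt_of_lt_of_le (isOpen_interior.measure_pos volume hi) (measure_mono ?_)
      intro x hx
      refine ⟨?_, hx⟩
      have := hl x hx
      simp only [Function.mem_support, map_sub]
      intro h; linarith
    · filter_upwards [ae_restrict_mem isOpen_interior.measurableSet] with x hx
      have := hl x hx
      simp only [map_sub, Pi.zero_apply]; linarith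
    · have hli : IntegrableOn (fun x => l (x - x₀)) K := l.integrable_comp hIntg
      exact (hli.mono_set interior_subset).neg
  rw [integral_neg, h1] at h2
  simp at h2

/-- Blaschke–Santaló inequality, normalized form. -/
theorem statement5 (n : ℕ) (hn : 1 ≤ n)
    (K : Set (EuclideanSpace ℝ (Fin n))) (hK : IsConvexBody K)
    (hvol : vol K = vol (unitBall n)) :
    entropyP (-(n : ℝ)) K ≤ n * vol (unitBall n) := by
  obtain ⟨x₀, hx₀, hz⟩ := centroid_mem hK
  obtain ⟨hc, hL, -⟩ := hK
  have : Nonempty (Fin n) := ⟨⟨0, hn⟩⟩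
  have hsph : sphMeasure n univ = ENNReal.ofReal (n * vol (unitBall n)) := by
    unfold sphMeasure vol unitBall
    rw [Measure.toSphere_apply_univ, ENNReal.ofReal_mul (by positivity), ENNReal.ofReal_natCast,
      ENNReal.ofReal_toReal (measure_closedBall_lt_top).ne, Measure.addHaar_closedBall_eq_addHaar_ball]
    simp
  let L : Set (EuclideanSpace ℝ (Fin n)) := (fun x => x + x₀) ⁻¹' K
  have hmp := measurePreserving_add_right (volume : Measure (EuclideanSpace ℝ (Fin n))) x₀
  have hLimg : L = (fun x => x - x₀) '' K := by
    ext x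
    constructor
    · intro h; exact ⟨x + x₀, h, by simp⟩
    · rintro ⟨y, hy, rfl⟩; simpa [L] using hy
  have hLc : IsCompact L := by
    rw [hLimg]; exact hc.image (by fun_prop)
  have hLconv : Convex ℝ L := hL.translate_preimage_left x₀
  have hL0 : L ∈ nhds 0 := by
    have : Continuous fun x : EuclideanSpace ℝ (Fin n) => x + x₀ := by fun_prop
    refine this.continuousAt.preimage_mem_nhds ?_
    rw [zero_add]; exact mem_interior_iff_mem_nhds.1 hx₀
  have hLvol : volume L = volume (closedBall (0 : EuclideanSpace ℝ (Fin n)) 1) := by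
    rw [hmp.measure_preimage hc.measurableSet.nullMeasurableSet]
    exact (ENNReal.toReal_eq_toReal_iff' hc.measure_lt_top.ne measure_closedBall_lt_top.ne).1 hvol
  have hLbar : ∫ x in L, x = 0 := by
    have := hmp.setIntegral_preimage_emb (measurableEmbedding_addRight x₀) (fun x => x - x₀) K
    rw [hz] at this
    simpa using this
  have hsupp : ∀ u, supp K u - ⟪x₀, u⟫ = supp L u := by
    intro u
    unfold supp
    rw [hLimg, image_image]
    have hb : BddAbove ((fun x => ⟪x, u⟫) '' K) :=
      (hc.image (f := fun x => ⟪x, u⟫) (by fun_prop)).bddAbove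
    have hne : ((fun x => ⟪x, u⟫) '' K).Nonempty := ⟨_, mem_image_of_mem _ (interior_subset hx₀)⟩
    have : (fun x => ⟪x - x₀, u⟫) '' K = (fun t => t - ⟪x₀, u⟫) '' ((fun x => ⟪x, u⟫) '' K) := by
      rw [image_image]; simp only [inner_sub_left]
    rw [this]
    have := (OrderIso.subRight ⟪x₀, u⟫).map_csSup' hne hb
    simpa using this
  have hcore := core hn hLc hLconv hL0 hLbar hLvol
  have hsm : Measurable (supp L) := (supp_cont hLc).measurable
  have hpos : ∀ u : sphere (0 : EuclideanSpace ℝ (Fin n)) 1,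
      0 < supp L (u : EuclideanSpace ℝ (Fin n)) := fun u =>
    supp_pos hLc hL0 (ne_zero_of_mem_unit_sphere u)
  refine (csInf_le ?_ (mem_image_of_mem _ hx₀)).trans ?_
  · refine ⟨0, ?_⟩
    rintro _ ⟨x, hx, rfl⟩
    refine integral_nonneg fun u => Real.rpow_nonneg ?_ _
    exact sub_nonneg.2 (le_supp hc (interior_subset hx) _)
  · simp only [hsupp]
    rw [integral_eq_lintegral_of_nonneg_ae]
    · refine ENNReal.toReal_le_of_le_ofReal ?_ (hcore.trans hsph.le)
      unfold vol; positivity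
    · exact Filter.Eventually.of_forall fun u => Real.rpow_nonneg (hpos u).le _
    · exact (by fun_prop : Measurable fun u : sphere (0 : EuclideanSpace ℝ (Fin n)) 1 =>
        supp L (u : EuclideanSpace ℝ (Fin n)) ^ (-(n : ℝ))).aestronglyMeasurable
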